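/- For every E-linear code C of length n, (Hull(C))_Res ⊆ Hull(C_Res) and (Hull(C))_Tor ⊇ Hull(C_Tor); moreover, if C is free then both inclusions are equalities. -/

import Mathlib

open scoped BigOperators

/-- The non-unital ring `E` of order 4: the pair `(u, v)` represents `uκ + vζ`,
where `ζ = κ + τ`.  Multiplication: `(uκ + vζ)·(u'κ + v'ζ) = u'·(uκ + vζ)`. -/
def RingE : Type := ZMod 2 × ZMod 2

namespace RingE

instance : AddCommGroup RingE := inferInstanceAs (AddCommGroup (ZMod 2 × ZMod 2))

instance : Mul RingE := ⟨fun a b => Prod.mk (Prod.fst a * Prod.fst b) (Prod.snd a * Prod.fst b)⟩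

noncomputable instance : DecidableEq RingE := Classical.decEq _

instance : NonUnitalRing RingE where
  left_distrib a b c := by
    show Prod.mk (Prod.fst a * (Prod.fst b + Prod.fst c))
        (Prod.snd a * (Prod.fst b + Prod.fst c)) = _
    show _ = Prod.mk (Prod.fst a * Prod.fst b + Prod.fst a * Prod.fst c)
        (Prod.snd a * Prod.fst b + Prod.snd a * Prod.fst c)
    simp [mul_add]
  right_distrib a b c := by
    show Prod.mk ((Prod.fst a + Prod.fst b) * Prod.fst c)
        ((Prod.snd a + Prod.snd b) * Prod.fst c) = _
    show _ = Prod.mk (Prod.fst a * Prod.fst c + Prod.fst b * Prod.fst c)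
        (Prod.snd a * Prod.fst c + Prod.snd b * Prod.fst c)
    simp [add_mul]
  zero_mul a := by
    show Prod.mk ((0 : ZMod 2) * Prod.fst a) ((0 : ZMod 2) * Prod.fst a) = ((0 : ZMod 2), (0 : ZMod 2))
    simp
  mul_zero a := by
    show Prod.mk (Prod.fst a * (0 : ZMod 2)) (Prod.snd a * (0 : ZMod 2)) = ((0 : ZMod 2), (0 : ZMod 2))
    simp
  mul_assoc a b c := by
    show Prod.mk (Prod.fst a * Prod.fst b * Prod.fst c) (Prod.snd a * Prod.fst b * Prod.fst c)
      = Prod.mk (Prod.fst a * (Prod.fst b * Prod.fst c)) (Prod.snd a * (Prod.fst b * Prod.fst c))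
    simp [mul_assoc]

/-- The generator `κ`. -/
def kappa : RingE := Prod.mk 1 0

/-- The generator `τ`. -/
def tau : RingE := Prod.mk 1 1

/-- `ζ = κ + τ`. -/
def zeta : RingE := Prod.mk 0 1

/-- The reduction map `π : E → F₂`, sending `uκ + vζ` to `u`. -/
def pi (a : RingE) : ZMod 2 := Prod.fst a

/-- `κ·c` for a scalar `c ∈ F₂`, i.e. the element `cκ` of `E`. -/
def kappaSMul (c : ZMod 2) : RingE := Prod.mk c 0

/-- `ζ·c` for a scalar `c ∈ F₂`, i.e. the element `cζ` of `E`. -/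
def zetaSMul (c : ZMod 2) : RingE := Prod.mk 0 c

end RingE

namespace ECode

/-- Componentwise reduction `π : Eⁿ → F₂ⁿ`. -/
def piVec {n : ℕ} (x : Fin n → RingE) : Fin n → ZMod 2 := fun i => RingE.pi (x i)

/-- The vector `κv ∈ Eⁿ` attached to `v ∈ F₂ⁿ`. -/
def kappaVec {n : ℕ} (v : Fin n → ZMod 2) : Fin n → RingE := fun i => RingE.kappaSMul (v i)

/-- The vector `ζv ∈ Eⁿ` attached to `v ∈ F₂ⁿ`. -/
def zetaVec {n : ℕ} (v : Fin n → ZMod 2) : Fin n → RingE := fun i => RingE.zetaSMul (v i)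

/-- An `E`-linear code of length `n`: a left `E`-submodule of `Eⁿ`, i.e. an additive
subgroup closed under componentwise left multiplication by elements of `E`. -/
def IsECode {n : ℕ} (C : Set (Fin n → RingE)) : Prop :=
  (0 : Fin n → RingE) ∈ C ∧ (∀ x ∈ C, ∀ y ∈ C, x + y ∈ C) ∧ (∀ x ∈ C, -x ∈ C) ∧
    ∀ (a : RingE), ∀ x ∈ C, (fun i => a * x i) ∈ C

/-- The residue code `C_Res = π(C)`. -/
def Res {n : ℕ} (C : Set (Fin n → RingE)) : Set (Fin n → ZMod 2) := piVec '' C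

/-- The torsion code `C_Tor = {v ∈ F₂ⁿ : ζv ∈ C}`. -/
def Tor {n : ℕ} (C : Set (Fin n → RingE)) : Set (Fin n → ZMod 2) := {v | zetaVec v ∈ C}

/-- A code is free if its residue and torsion codes coincide. -/
def IsFree {n : ℕ} (C : Set (Fin n → RingE)) : Prop := Res C = Tor C

/-- The inner product on `Eⁿ`. -/
def Einner {n : ℕ} (w z : Fin n → RingE) : RingE := ∑ i, w i * z i

/-- The left dual `C^{⊥L}`. -/
def dualL {n : ℕ} (C : Set (Fin n → RingE)) : Set (Fin n → RingE) :=
  {z | ∀ w ∈ C, Einner z w = 0}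

/-- The right dual `C^{⊥R}`. -/
def dualR {n : ℕ} (C : Set (Fin n → RingE)) : Set (Fin n → RingE) :=
  {z | ∀ w ∈ C, Einner w z = 0}

/-- The (two-sided) dual `C^⊥ = C^{⊥L} ∩ C^{⊥R}`. -/
def dualE {n : ℕ} (C : Set (Fin n → RingE)) : Set (Fin n → RingE) := dualL C ∩ dualR C

/-- The left hull `LHull(C) = C ∩ C^{⊥L}`. -/
def LHull {n : ℕ} (C : Set (Fin n → RingE)) : Set (Fin n → RingE) := C ∩ dualL C

/-- The right hull `RHull(C) = C ∩ C^{⊥R}`. -/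
def RHull {n : ℕ} (C : Set (Fin n → RingE)) : Set (Fin n → RingE) := C ∩ dualR C

/-- The hull `Hull(C) = C ∩ C^⊥`. -/
def EHull {n : ℕ} (C : Set (Fin n → RingE)) : Set (Fin n → RingE) := C ∩ dualE C

/-- The Euclidean inner product on `F₂ⁿ`. -/
def Finner {n : ℕ} (w z : Fin n → ZMod 2) : ZMod 2 := ∑ i, w i * z i

/-- The Euclidean dual of an `F₂`-linear code. -/
def dualF {n : ℕ} (B : Set (Fin n → ZMod 2)) : Set (Fin n → ZMod 2) :=
  {z | ∀ w ∈ B, Finner w z = 0}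

/-- The hull of an `F₂`-linear code. -/
def FHull {n : ℕ} (B : Set (Fin n → ZMod 2)) : Set (Fin n → ZMod 2) := B ∩ dualF B

/-- `F₂`-dimension of an `F₂`-linear code (as the dimension of its span). -/
noncomputable def dimF {n : ℕ} (B : Set (Fin n → ZMod 2)) : ℕ :=
  Module.finrank (ZMod 2) (Submodule.span (ZMod 2) B)

/-- Scalar multiplication of a vector of `Eⁿ` by `a ∈ E`. -/
def smulVec {n : ℕ} (a : RingE) (x : Fin n → RingE) : Fin n → RingE := fun i => a * x i

/-- The left `E`-span `⟨X⟩_E` of a finite set `X ⊆ Eⁿ`. -/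
def spanE {n : ℕ} (X : Finset (Fin n → RingE)) : Set (Fin n → RingE) :=
  {y | ∃ c : (Fin n → RingE) → RingE, y = ∑ x ∈ X, smulVec (c x) x}

/-- The additive (`F₂`-) span `⟨X⟩_{F₂}` of a finite set `X ⊆ Eⁿ`: all sums of subsets. -/
def spanF {n : ℕ} (X : Finset (Fin n → RingE)) : Set (Fin n → RingE) :=
  {y | ∃ S : Finset (Fin n → RingE), S ⊆ X ∧ y = ∑ x ∈ S, x}

/-- `X` is a generating set of the code `D` if `⟨X⟩_E ∪ ⟨X⟩_{F₂} = D`. -/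
def IsGenSet {n : ℕ} (X : Finset (Fin n → RingE)) (D : Set (Fin n → RingE)) : Prop :=
  spanE X ∪ spanF X = D

/-- The rank of a (free) code: the minimum cardinality of a generating set. -/
noncomputable def genRank {n : ℕ} (D : Set (Fin n → RingE)) : ℕ :=
  sInf {m | ∃ X : Finset (Fin n → RingE), X.card = m ∧ IsGenSet X D}

/-- Prepending two coordinates to a vector of length `n`. -/
def cons2 {n : ℕ} (a b : RingE) (x : Fin n → RingE) : Fin (n + 2) → RingE :=
  Fin.cons a (Fin.cons b x)

end ECode

namespace ECode

/-- The vector of `ζ`-coordinates. -/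
def sndVec {n : ℕ} (x : Fin n → RingE) : Fin n → ZMod 2 := fun i => Prod.snd (x i)

theorem Einner_eq {n : ℕ} (w z : Fin n → RingE) :
    Einner w z = (Prod.mk (Finner (piVec w) (piVec z)) (Finner (sndVec w) (piVec z)) : RingE) := by
  refine Prod.ext ?_ ?_
  · exact map_sum (AddMonoidHom.fst (ZMod 2) (ZMod 2)) (fun i => w i * z i) Finset.univ
  · exact map_sum (AddMonoidHom.snd (ZMod 2) (ZMod 2)) (fun i => w i * z i) Finset.univ

theorem Einner_zero {n : ℕ} (w z : Fin n → RingE) :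
    Einner w z = 0 ↔ Finner (piVec w) (piVec z) = 0 ∧ Finner (sndVec w) (piVec z) = 0 := by
  rw [Einner_eq]
  exact Prod.mk_inj

theorem Finner_comm {n : ℕ} (w z : Fin n → ZMod 2) : Finner w z = Finner z w := by
  simp only [Finner, mul_comm]

theorem Finner_zero_left {n : ℕ} (z : Fin n → ZMod 2) : Finner (fun _ => 0) z = 0 := by
  simp [Finner]

theorem Finner_zero_right {n : ℕ} (z : Fin n → ZMod 2) : Finner z (fun _ => 0) = 0 := by
  simp [Finner]

theorem kappaVec_mem {n : ℕ} {C : Set (Fin n → RingE)} (hC : IsECode C) {x : Fin n → RingE}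
    (hx : x ∈ C) : kappaVec (piVec x) ∈ C := by
  have h := hC.2.2.2 RingE.kappa x hx
  convert h using 1
  funext i
  refine Prod.ext ?_ ?_
  · exact (one_mul (piVec x i)).symm
  · exact (zero_mul (piVec x i)).symm

theorem zetaVec_mem {n : ℕ} {C : Set (Fin n → RingE)} (hC : IsECode C) {x : Fin n → RingE}
    (hx : x ∈ C) : zetaVec (piVec x) ∈ C := by
  have h := hC.2.2.2 RingE.zeta x hx
  convert h using 1
  funext i
  refine Prod.ext ?_ ?_
  · exact (zero_mul (piVec x i)).symm
  · exact (one_mul (piVec x i)).symm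

theorem sndVec_mem {n : ℕ} {C : Set (Fin n → RingE)} (hC : IsECode C) {x : Fin n → RingE}
    (hx : x ∈ C) : zetaVec (sndVec x) ∈ C := by
  have h := hC.2.1 x hx _ (hC.2.2.1 _ (kappaVec_mem hC hx))
  convert h using 1
  funext i
  refine Prod.ext ?_ ?_
  · exact (add_neg_cancel (piVec x i)).symm
  · show sndVec x i = sndVec x i + -(0 : ZMod 2)
    simp

/-- The residue of the hull is `C_Res ∩ C_Tor^⊥`. -/
theorem res_hull {n : ℕ} {C : Set (Fin n → RingE)} (hC : IsECode C) :
    Res (EHull C) = Res C ∩ dualF (Tor C) := by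
  ext v
  constructor
  · rintro ⟨x, ⟨hx, -, hR⟩, rfl⟩
    exact ⟨⟨x, hx, rfl⟩, fun w hw => ((Einner_zero _ _).1 (hR _ hw)).2⟩
  · rintro ⟨⟨x, hx, rfl⟩, hd⟩
    refine ⟨kappaVec (piVec x), ⟨kappaVec_mem hC hx, fun w hw => ?_, fun w hw => ?_⟩, rfl⟩
    · refine (Einner_zero _ _).2 ⟨?_, Finner_zero_left _⟩
      rw [Finner_comm]
      exact hd _ (zetaVec_mem hC hw)
    · exact (Einner_zero _ _).2 ⟨hd _ (zetaVec_mem hC hw), hd _ (sndVec_mem hC hw)⟩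

/-- The torsion of the hull is `C_Tor ∩ C_Res^⊥`. -/
theorem tor_hull {n : ℕ} {C : Set (Fin n → RingE)} :
    Tor (EHull C) = Tor C ∩ dualF (Res C) := by
  ext v
  constructor
  · rintro ⟨hx, hL, -⟩
    refine ⟨hx, ?_⟩
    rintro _ ⟨w, hw, rfl⟩
    rw [Finner_comm]
    exact ((Einner_zero _ _).1 (hL _ hw)).2
  · rintro ⟨hx, hd⟩
    refine ⟨hx, fun w hw => ?_, fun w hw => ?_⟩
    · refine (Einner_zero _ _).2 ⟨Finner_zero_left _, ?_⟩
      have h := hd _ ⟨w, hw, rfl⟩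
      rw [Finner_comm] at h
      exact h
    · exact (Einner_zero _ _).2 ⟨Finner_zero_right _, Finner_zero_right _⟩

theorem res_sub_tor {n : ℕ} {C : Set (Fin n → RingE)} (hC : IsECode C) : Res C ⊆ Tor C := by
  rintro _ ⟨x, hx, rfl⟩
  exact zetaVec_mem hC hx

end ECode

open ECode in
/-- `(Hull C)_Res ⊆ Hull(C_Res)` and `(Hull C)_Tor ⊇ Hull(C_Tor)`, with
equalities when `C` is free. -/
theorem hull_res_tor_inclusions {n : ℕ} (C : Set (Fin n → RingE)) (hC : IsECode C) :
    Res (EHull C) ⊆ FHull (Res C) ∧ FHull (Tor C) ⊆ Tor (EHull C) ∧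
      (IsFree C → Res (EHull C) = FHull (Res C) ∧ Tor (EHull C) = FHull (Tor C)) := by
  rw [res_hull hC, tor_hull]
  refine ⟨fun v hv => ⟨hv.1, fun w hw => hv.2 w (res_sub_tor hC hw)⟩,
    fun v hv => ⟨hv.1, fun w hw => hv.2 w (res_sub_tor hC hw)⟩, fun hF => ?_⟩
  have hF' : Res C = Tor C := hF
  rw [hF']
  exact ⟨rfl, rfl⟩
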